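/- arXiv:1103.1085 — 2 statements merged into one kernel-verified Lean document; each statement's English description precedes it below -/
import Mathlib

section
/- Let λ, μ ∈ ℂ with λ ≠ μ. In ℂ⁴ with standard basis e_1,...,e_4, write e_123 = e_1 + e_2 + e_3 and e_24 = e_2 + e_4, and consider the subspaces V_1 = span{e_123, e_24}, V_2 = span{e_4}, V_3 = span{e_1, e_4}, V_4(ν) = span{e_1, e_4, e_2 + ν e_3}, V_5 = span{e_3}, V_6 = span{e_2, e_3}, V_7 = span{e_1, e_2, e_3}. Then there is no invertible linear map g : ℂ⁴ → ℂ⁴ such that g(V_i) = V_i for i ∈ {1,2,3,5,6,7} and g(V_4(λ)) = V_4(μ). -/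
/-- The `i`-th standard basis vector of `ℂⁿ`. -/
noncomputable def e {n : ℕ} (i : Fin n) : Fin n → ℂ := Pi.single i 1

/-- If `f` maps the span of `s` onto `W`, it sends each generator into `W`. -/
theorem apply_mem_of_map_span_eq {R M N : Type*} [Semiring R] [AddCommMonoid M] [AddCommMonoid N]
    [Module R M] [Module R N] {f : M →ₗ[R] N} {s : Set M} {W : Submodule R N}
    (h : (Submodule.span R s).map f = W) {x : M} (hx : x ∈ s) : f x ∈ W :=
  h ▸ Submodule.mem_map_of_mem (Submodule.subset_span hx)

/-- **Nonequivalence of the representations `𝒱_λ((1,3,3))`.**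
With `e₁₂₃ = e₁ + e₂ + e₃` and `e₂₄ = e₂ + e₄` in `ℂ⁴`, for `λ ≠ μ` there is no
invertible linear map `g : ℂ⁴ → ℂ⁴` fixing `⟨e₁₂₃,e₂₄⟩`, `⟨e₄⟩`, `⟨e₁,e₄⟩`,
`⟨e₃⟩`, `⟨e₂,e₃⟩`, `⟨e₁,e₂,e₃⟩` and sending `⟨e₁,e₄,e₂+λe₃⟩` to
`⟨e₁,e₄,e₂+μe₃⟩`. -/
theorem nonequiv_133 (lam mu : ℂ) (h : lam ≠ mu) :
    ¬ ∃ g : (Fin 4 → ℂ) ≃ₗ[ℂ] (Fin 4 → ℂ),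
      (Submodule.span ℂ {e 0 + e 1 + e 2, e 1 + e 3}).map g.toLinearMap =
        Submodule.span ℂ {e 0 + e 1 + e 2, e 1 + e 3} ∧
      (Submodule.span ℂ {e 3}).map g.toLinearMap = Submodule.span ℂ {e 3} ∧
      (Submodule.span ℂ {e 0, e 3}).map g.toLinearMap = Submodule.span ℂ {e 0, e 3} ∧
      (Submodule.span ℂ {e 0, e 3, e 1 + lam • e 2}).map g.toLinearMap =
        Submodule.span ℂ {e 0, e 3, e 1 + mu • e 2} ∧
      (Submodule.span ℂ {e 2}).map g.toLinearMap = Submodule.span ℂ {e 2} ∧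
      (Submodule.span ℂ {e 1, e 2}).map g.toLinearMap = Submodule.span ℂ {e 1, e 2} ∧
      (Submodule.span ℂ {e 0, e 1, e 2}).map g.toLinearMap =
        Submodule.span ℂ {e 0, e 1, e 2} := by
  rintro ⟨g, h1, h2, h3, h4, h5, h6, h7⟩
  have m1 := apply_mem_of_map_span_eq h1 (x := e 0 + e 1 + e 2) (by simp)
  have m1' := apply_mem_of_map_span_eq h1 (x := e 1 + e 3) (by simp)
  have m2 := apply_mem_of_map_span_eq h2 (x := e 3) (by simp)
  have m3 := apply_mem_of_map_span_eq h3 (x := e 0) (by simp)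
  have m4 := apply_mem_of_map_span_eq h4 (x := e 1 + lam • e 2) (by simp)
  have m5 := apply_mem_of_map_span_eq h5 (x := e 2) (by simp)
  have m6 := apply_mem_of_map_span_eq h6 (x := e 1) (by simp)
  have m7 := apply_mem_of_map_span_eq h7 (x := e 0) (by simp)
  have hne : g (e 2) ≠ 0 := by
    rw [Ne, LinearEquiv.map_eq_zero_iff]
    exact fun hz => by simpa [e] using congrFun hz 2
  simp only [Submodule.mem_span_singleton, Submodule.mem_span_pair, Submodule.mem_span_triple,
    map_add, map_smul, LinearEquiv.coe_coe] at m1 m1' m2 m3 m4 m5 m6 m7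
  obtain ⟨a, ha⟩ := m2
  obtain ⟨b, hb⟩ := m5
  obtain ⟨c, c', hc⟩ := m3
  obtain ⟨u, v, w, hu⟩ := m7
  obtain ⟨d, f, hd⟩ := m6
  obtain ⟨x, y, hx⟩ := m1
  obtain ⟨z, t, hz⟩ := m1'
  obtain ⟨p, q, r, hp⟩ := m4
  have hb0 : b ≠ 0 := by
    rintro rfl
    exact hne (by simpa using hb.symm)
  rw [← hc] at hu
  rw [← hc, ← hd, ← hb] at hx
  rw [← hd, ← ha] at hz
  rw [← hd, ← hb] at hp
  have u3 := congrFun hu 3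
  have x0 := congrFun hx 0
  have x1 := congrFun hx 1
  have x2 := congrFun hx 2
  have x3 := congrFun hx 3
  have z0 := congrFun hz 0
  have z2 := congrFun hz 2
  have p1 := congrFun hp 1
  have p2 := congrFun hp 2
  simp [e] at u3 x0 x1 x2 x3 z0 z2 p1 p2
  apply h
  apply mul_right_cancel₀ hb0
  grind
end

section
/- Let λ ∈ ℂ with λ ≠ 0 and λ ≠ 1. In ℂ⁴ with standard basis e_1,...,e_4, write e_123 = e_1 + e_2 + e_3 and e_24 = e_2 + e_4, and consider the subspaces V_1 = span{e_123, e_24}, V_2 = span{e_4}, V_3 = span{e_1, e_4}, V_4 = span{e_1, e_4, e_2 + λ e_3}, V_5 = span{e_3}, V_6 = span{e_2, e_3}, V_7 = span{e_1, e_2, e_3}, with weights χ_1 = 2/4 and χ_i = 1/4 for i = 2,...,7. Then this system is χ-stable: Σ_{i=1}^{7} χ_i dim V_i = dim ℂ⁴ = 4, and for every subspace M of ℂ⁴ with M ≠ 0 and M ≠ ℂ⁴ one has Σ_{i=1}^{7} χ_i dim(V_i ∩ M) < dim M. -/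
open Module

/-- The subspaces of the representation `𝒱_λ((1,3,3))` of the critical poset
`(1,3,3)` in `ℂ⁴` (with `e₁₂₃ = e₁+e₂+e₃`, `e₂₄ = e₂+e₄`). -/
noncomputable def V133 (lam : ℂ) : Fin 7 → Submodule ℂ (Fin 4 → ℂ) :=
  ![Submodule.span ℂ {e 0 + e 1 + e 2, e 1 + e 3},
    Submodule.span ℂ {e 3},
    Submodule.span ℂ {e 0, e 3},
    Submodule.span ℂ {e 0, e 3, e 1 + lam • e 2},
    Submodule.span ℂ {e 2},
    Submodule.span ℂ {e 1, e 2},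
    Submodule.span ℂ {e 0, e 1, e 2}]

/-- The weight `(2/4, 1/4, 1/4, 1/4, 1/4, 1/4, 1/4)` for `𝒱_λ((1,3,3))`. -/
noncomputable def chi133 : Fin 7 → ℝ :=
  ![2 / 4, 1 / 4, 1 / 4, 1 / 4, 1 / 4, 1 / 4, 1 / 4]

section

variable {K V : Type*} [DivisionRing K] [AddCommGroup V] [Module K V] [FiniteDimensional K V]

theorem finrank_inf_add_finrank_inf_le (A B M : Submodule K V) :
    finrank K ↥(A ⊓ M) + finrank K ↥(B ⊓ M) ≤
      finrank K ↥((A ⊔ B) ⊓ M) + finrank K ↥((A ⊓ B) ⊓ M) := by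
  rw [← Submodule.finrank_sup_add_finrank_inf_eq, ← inf_inf_distrib_right]
  exact Nat.add_le_add_right (Submodule.finrank_mono (sup_le
    (inf_le_inf_right M le_sup_left) (inf_le_inf_right M le_sup_right))) _

theorem finrank_inf_add_finrank_inf_le_finrank_add (A B M : Submodule K V) :
    finrank K ↥(A ⊓ M) + finrank K ↥(B ⊓ M) ≤
      finrank K M + finrank K ↥((A ⊓ B) ⊓ M) :=
  (finrank_inf_add_finrank_inf_le A B M).trans
    (Nat.add_le_add_right (Submodule.finrank_mono inf_le_right) _)

theorem finrank_inf_add_finrank_inf_le_of_disjoint {A B : Submodule K V} (h : Disjoint A B)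
    (M : Submodule K V) :
    finrank K ↥(A ⊓ M) + finrank K ↥(B ⊓ M) ≤ finrank K ↥((A ⊔ B) ⊓ M) := by
  have h' := finrank_inf_add_finrank_inf_le A B M
  rwa [h.eq_bot, bot_inf_eq, finrank_bot, add_zero] at h'

theorem finrank_inf_add_finrank_inf_le_finrank_of_disjoint {A B : Submodule K V}
    (h : Disjoint A B) (M : Submodule K V) :
    finrank K ↥(A ⊓ M) + finrank K ↥(B ⊓ M) ≤ finrank K M :=
  (finrank_inf_add_finrank_inf_le_of_disjoint h M).trans (Submodule.finrank_mono inf_le_right)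

end

theorem finrank_span_eq_of_range_eq {k n : ℕ} (v : Fin k → Fin n → ℂ) {s : Set (Fin n → ℂ)}
    (hs : Set.range v = s)
    (hv : ∀ g : Fin k → ℂ, (∀ j, ∑ i, g i * v i j = 0) → ∀ i, g i = 0) :
    finrank ℂ (Submodule.span ℂ s) = k := by
  subst hs
  have h : LinearIndependent ℂ v := Fintype.linearIndependent_iff.2 fun g hg =>
    hv g fun j => by simpa using congrFun hg j
  simpa using finrank_span_eq_card h

theorem finrank_V133 (lam : ℂ) (i : Fin 7) :
    finrank ℂ (V133 lam i) = ![2, 1, 2, 3, 1, 2, 3] i := by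
  fin_cases i
  · exact finrank_span_eq_of_range_eq ![e 0 + e 1 + e 2, e 1 + e 3]
      (by simp only [Matrix.range_cons, Matrix.range_empty, Set.union_empty, Set.singleton_union])
      (by simp +contextual [Fin.forall_fin_succ, Fin.sum_univ_succ, e, Pi.single_apply])
  · exact finrank_span_eq_of_range_eq ![e 3]
      (by simp only [Matrix.range_cons, Matrix.range_empty, Set.union_empty])
      (by simp +contextual [Fin.forall_fin_succ, e, Pi.single_apply])
  · exact finrank_span_eq_of_range_eq ![e 0, e 3]
      (by simp only [Matrix.range_cons, Matrix.range_empty, Set.union_empty, Set.singleton_union])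
      (by simp +contextual [Fin.forall_fin_succ, Fin.sum_univ_succ, e, Pi.single_apply])
  · exact finrank_span_eq_of_range_eq ![e 0, e 3, e 1 + lam • e 2]
      (by simp only [Matrix.range_cons, Matrix.range_empty, Set.union_empty, Set.singleton_union])
      (by simp +contextual [Fin.forall_fin_succ, Fin.sum_univ_succ, e, Pi.single_apply])
  · exact finrank_span_eq_of_range_eq ![e 2]
      (by simp only [Matrix.range_cons, Matrix.range_empty, Set.union_empty])
      (by simp +contextual [Fin.forall_fin_succ, e, Pi.single_apply])
  · exact finrank_span_eq_of_range_eq ![e 1, e 2]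
      (by simp only [Matrix.range_cons, Matrix.range_empty, Set.union_empty, Set.singleton_union])
      (by simp +contextual [Fin.forall_fin_succ, Fin.sum_univ_succ, e, Pi.single_apply])
  · exact finrank_span_eq_of_range_eq ![e 0, e 1, e 2]
      (by simp only [Matrix.range_cons, Matrix.range_empty, Set.union_empty, Set.singleton_union])
      (by simp +contextual [Fin.forall_fin_succ, Fin.sum_univ_succ, e, Pi.single_apply])

theorem mem_V133_zero {lam : ℂ} {x : Fin 4 → ℂ} :
    x ∈ V133 lam 0 ↔ x 0 = x 2 ∧ x 1 = x 0 + x 3 := by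
  refine Submodule.mem_span_pair.trans ⟨?_, ?_⟩
  · rintro ⟨a, b, rfl⟩
    simp [e]
  · rintro ⟨h1, h2⟩
    refine ⟨x 0, x 3, ?_⟩
    ext i
    fin_cases i <;> simp [e, h1, h2]

theorem mem_V133_one {lam : ℂ} {x : Fin 4 → ℂ} :
    x ∈ V133 lam 1 ↔ x 0 = 0 ∧ x 1 = 0 ∧ x 2 = 0 := by
  refine Submodule.mem_span_singleton.trans ⟨?_, ?_⟩
  · rintro ⟨a, rfl⟩
    simp [e]
  · rintro ⟨h1, h2, h3⟩
    refine ⟨x 3, ?_⟩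
    ext i
    fin_cases i <;> simp [e, h1, h2, h3]

theorem mem_V133_two {lam : ℂ} {x : Fin 4 → ℂ} :
    x ∈ V133 lam 2 ↔ x 1 = 0 ∧ x 2 = 0 := by
  refine Submodule.mem_span_pair.trans ⟨?_, ?_⟩
  · rintro ⟨a, b, rfl⟩
    simp [e]
  · rintro ⟨h1, h2⟩
    refine ⟨x 0, x 3, ?_⟩
    ext i
    fin_cases i <;> simp [e, h1, h2]

theorem mem_V133_three {lam : ℂ} {x : Fin 4 → ℂ} :
    x ∈ V133 lam 3 ↔ x 2 = lam * x 1 := by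
  refine Submodule.mem_span_triple.trans ⟨?_, ?_⟩
  · rintro ⟨a, b, c, rfl⟩
    simp [e, mul_comm]
  · rintro h
    refine ⟨x 0, x 3, x 1, ?_⟩
    ext i
    fin_cases i <;> simp [e, h, mul_comm]

theorem mem_V133_four {lam : ℂ} {x : Fin 4 → ℂ} :
    x ∈ V133 lam 4 ↔ x 0 = 0 ∧ x 1 = 0 ∧ x 3 = 0 := by
  refine Submodule.mem_span_singleton.trans ⟨?_, ?_⟩
  · rintro ⟨a, rfl⟩
    simp [e]
  · rintro ⟨h1, h2, h3⟩
    refine ⟨x 2, ?_⟩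
    ext i
    fin_cases i <;> simp [e, h1, h2, h3]

theorem mem_V133_five {lam : ℂ} {x : Fin 4 → ℂ} :
    x ∈ V133 lam 5 ↔ x 0 = 0 ∧ x 3 = 0 := by
  refine Submodule.mem_span_pair.trans ⟨?_, ?_⟩
  · rintro ⟨a, b, rfl⟩
    simp [e]
  · rintro ⟨h1, h2⟩
    refine ⟨x 1, x 2, ?_⟩
    ext i
    fin_cases i <;> simp [e, h1, h2]

theorem mem_V133_six {lam : ℂ} {x : Fin 4 → ℂ} :
    x ∈ V133 lam 6 ↔ x 3 = 0 := by
  refine Submodule.mem_span_triple.trans ⟨?_, ?_⟩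
  · rintro ⟨a, b, c, rfl⟩
    simp [e]
  · rintro h
    refine ⟨x 0, x 1, x 2, ?_⟩
    ext i
    fin_cases i <;> simp [e, h]

theorem weighted_finrank_V133_inf_lt {lam : ℂ} (h0 : lam ≠ 0) (h1 : lam ≠ 1)
    {M : Submodule ℂ (Fin 4 → ℂ)} (hbot : M ≠ ⊥) (htop : M ≠ ⊤) :
    2 * finrank ℂ ↥(V133 lam 0 ⊓ M) + finrank ℂ ↥(V133 lam 1 ⊓ M) +
      finrank ℂ ↥(V133 lam 2 ⊓ M) + finrank ℂ ↥(V133 lam 3 ⊓ M) +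
      finrank ℂ ↥(V133 lam 4 ⊓ M) + finrank ℂ ↥(V133 lam 5 ⊓ M) +
      finrank ℂ ↥(V133 lam 6 ⊓ M) < 4 * finrank ℂ M := by
  have h02 : Disjoint (V133 lam 0) (V133 lam 2) := Submodule.disjoint_def.2 fun x ha hb => by
    rw [mem_V133_zero] at ha
    rw [mem_V133_two] at hb
    ext i
    fin_cases i <;> simp <;> grind
  have h05 : Disjoint (V133 lam 0) (V133 lam 5) := Submodule.disjoint_def.2 fun x ha hb => by
    rw [mem_V133_zero] at ha
    rw [mem_V133_five] at hb
    ext i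
    fin_cases i <;> simp <;> grind
  have h16 : Disjoint (V133 lam 1) (V133 lam 6) := Submodule.disjoint_def.2 fun x ha hb => by
    rw [mem_V133_one] at ha
    rw [mem_V133_six] at hb
    ext i
    fin_cases i <;> simp <;> grind
  have h34 : Disjoint (V133 lam 3) (V133 lam 4) := Submodule.disjoint_def.2 fun x ha hb => by
    rw [mem_V133_three] at ha
    rw [mem_V133_four] at hb
    ext i
    fin_cases i <;> simp <;> grind
  have h25 : Disjoint (V133 lam 2) (V133 lam 5) := Submodule.disjoint_def.2 fun x ha hb => by
    rw [mem_V133_two] at ha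
    rw [mem_V133_five] at hb
    ext i
    fin_cases i <;> simp <;> grind
  have h14 : Disjoint (V133 lam 1) (V133 lam 4) := Submodule.disjoint_def.2 fun x ha hb => by
    rw [mem_V133_one] at ha
    rw [mem_V133_four] at hb
    ext i
    fin_cases i <;> simp <;> grind
  have hP : Disjoint (V133 lam 0) (V133 lam 3 ⊓ V133 lam 6) := by
    refine Submodule.disjoint_def.2 fun x ha hb => ?_
    simp only [Submodule.mem_inf, mem_V133_zero, mem_V133_three, mem_V133_six] at ha hb
    ext i
    fin_cases i <;> simp <;> grind
  have hL1 : Disjoint (V133 lam 3 ⊓ V133 lam 5) (V133 lam 1) := by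
    refine Submodule.disjoint_def.2 fun x ha hb => ?_
    simp only [Submodule.mem_inf, mem_V133_one, mem_V133_three, mem_V133_five] at ha hb
    ext i
    fin_cases i <;> simp <;> grind
  have hE4 : Disjoint (V133 lam 2 ⊓ V133 lam 6) (V133 lam 4) := by
    refine Submodule.disjoint_def.2 fun x ha hb => ?_
    simp only [Submodule.mem_inf, mem_V133_two, mem_V133_four, mem_V133_six] at ha hb
    ext i
    fin_cases i <;> simp <;> grind
  have hS : Disjoint (V133 lam 0) (V133 lam 1 ⊔ V133 lam 4) := by
    refine Submodule.disjoint_def.2 fun x ha hb => ?_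
    obtain ⟨y, hy, z, hz, rfl⟩ := Submodule.mem_sup.1 hb
    simp only [mem_V133_zero, mem_V133_one, mem_V133_four,
      Pi.add_apply] at ha hy hz
    ext i
    fin_cases i <;> simp <;> grind
  have hT : Disjoint (V133 lam 0) ((V133 lam 3 ⊓ V133 lam 5) ⊔ V133 lam 1) := by
    refine Submodule.disjoint_def.2 fun x ha hb => ?_
    obtain ⟨y, hy, z, hz, rfl⟩ := Submodule.mem_sup.1 hb
    simp only [Submodule.mem_inf, mem_V133_zero, mem_V133_one, mem_V133_three, mem_V133_five,
      Pi.add_apply] at ha hy hz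
    ext i
    fin_cases i <;> simp <;> grind
  have hU : Disjoint (V133 lam 0) ((V133 lam 2 ⊓ V133 lam 6) ⊔ V133 lam 4) := by
    refine Submodule.disjoint_def.2 fun x ha hb => ?_
    obtain ⟨y, hy, z, hz, rfl⟩ := Submodule.mem_sup.1 hb
    simp only [Submodule.mem_inf, mem_V133_zero, mem_V133_two, mem_V133_four, mem_V133_six,
      Pi.add_apply] at ha hy hz
    ext i
    fin_cases i <;> simp <;> grind
  have hpos : 0 < finrank ℂ M := Nat.pos_of_ne_zero (mt Submodule.finrank_eq_zero.1 hbot)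
  have hlt : finrank ℂ M < 4 := by simpa using Submodule.finrank_lt htop
  have hle : finrank ℂ ↥(V133 lam 0 ⊓ M) ≤ 2 :=
    (Submodule.finrank_mono inf_le_left).trans (finrank_V133 lam 0).le
  have d02 := finrank_inf_add_finrank_inf_le_finrank_of_disjoint h02 M
  have d05 := finrank_inf_add_finrank_inf_le_finrank_of_disjoint h05 M
  have d16 := finrank_inf_add_finrank_inf_le_finrank_of_disjoint h16 M
  have d34 := finrank_inf_add_finrank_inf_le_finrank_of_disjoint h34 M
  have d25 := finrank_inf_add_finrank_inf_le_finrank_of_disjoint h25 M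
  have dP := finrank_inf_add_finrank_inf_le_finrank_of_disjoint hP M
  have dS := finrank_inf_add_finrank_inf_le_finrank_of_disjoint hS M
  have dT := finrank_inf_add_finrank_inf_le_finrank_of_disjoint hT M
  have dU := finrank_inf_add_finrank_inf_le_finrank_of_disjoint hU M
  have s14 := finrank_inf_add_finrank_inf_le_of_disjoint h14 M
  have sL1 := finrank_inf_add_finrank_inf_le_of_disjoint hL1 M
  have sE4 := finrank_inf_add_finrank_inf_le_of_disjoint hE4 M
  have m36 := finrank_inf_add_finrank_inf_le_finrank_add (V133 lam 3) (V133 lam 6) M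
  have m35 := finrank_inf_add_finrank_inf_le_finrank_add (V133 lam 3) (V133 lam 5) M
  have m26 := finrank_inf_add_finrank_inf_le_finrank_add (V133 lam 2) (V133 lam 6) M
  generalize finrank ℂ M = m at *
  obtain rfl | rfl | rfl : m = 1 ∨ m = 2 ∨ m = 3 := by omega
  all_goals
    obtain h | h | h : finrank ℂ ↥(V133 lam 0 ⊓ M) = 0 ∨ finrank ℂ ↥(V133 lam 0 ⊓ M) = 1 ∨
      finrank ℂ ↥(V133 lam 0 ⊓ M) = 2 := by omega
    all_goals omega

/-- **Stability of `𝒱_λ((1,3,3))`** for the weight `χ = (2/4, 1/4, …, 1/4)`,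
for any `λ ∉ {0, 1}`. -/
theorem stable_133 (lam : ℂ) (h0 : lam ≠ 0) (h1 : lam ≠ 1) :
    (∑ i : Fin 7, chi133 i * (finrank ℂ (V133 lam i) : ℝ)) =
        (finrank ℂ (Fin 4 → ℂ) : ℝ) ∧
    finrank ℂ (Fin 4 → ℂ) = 4 ∧
    ∀ M : Submodule ℂ (Fin 4 → ℂ), M ≠ ⊥ → M ≠ ⊤ →
      (∑ i : Fin 7, chi133 i * (finrank ℂ ↥(V133 lam i ⊓ M) : ℝ)) <
        (finrank ℂ M : ℝ) := by
  refine ⟨?_, by simp, fun M hbot htop => ?_⟩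
  · simp only [Fin.sum_univ_seven, finrank_V133, chi133, Matrix.cons_val, finrank_fin_fun]
    norm_num
  have key := weighted_finrank_V133_inf_lt h0 h1 hbot htop
  rify at key
  simp only [Fin.sum_univ_seven, chi133, Matrix.cons_val]
  linarith
end
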